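/- arXiv:2008.06773 — 3 statements merged into one kernel-verified Lean document; each statement's English description precedes it below -/
import Mathlib

section
/- Let ℓ : ℝ^{pm} → ℝ be concave, let λ ≥ 0, and partition each β ∈ ℝ^{pm} into p blocks β_1,…,β_p ∈ ℝ^m. Suppose β̂ is a global maximizer of the penalized objective β ↦ ℓ(β) − λ·Σ_{j=1}^p ‖β_j‖₂. Then for every β⁰ ∈ ℝ^{pm} and every t ∈ [0,1], the convex combination β* = t β̂ + (1−t) β⁰ satisfies ℓ(β*) − ℓ(β⁰) ≥ λ·Σ_{j=1}^p ( ‖β*_j‖₂ − ‖β⁰_j‖₂ ). -/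
/-- Basic inequality for a group-lasso-penalized concave objective: at a global
maximizer `β̂` of `β ↦ ℓ(β) − λ Σ_j ‖β_j‖₂`, every convex combination
`β* = t β̂ + (1−t) β⁰` satisfies `ℓ(β*) − ℓ(β⁰) ≥ λ Σ_j (‖β*_j‖₂ − ‖β⁰_j‖₂)`. -/
theorem stmt7
    (p m : ℕ) (ℓ : (Fin p → Fin m → ℝ) → ℝ)
    (hconc : ConcaveOn ℝ Set.univ ℓ) (lam : ℝ) (hlam : 0 ≤ lam)
    (βhat : Fin p → Fin m → ℝ)
    (hmax : ∀ β : Fin p → Fin m → ℝ,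
      ℓ β - lam * ∑ j, Real.sqrt (∑ l, (β j l) ^ 2)
        ≤ ℓ βhat - lam * ∑ j, Real.sqrt (∑ l, (βhat j l) ^ 2)) :
    ∀ β0 : Fin p → Fin m → ℝ, ∀ t ∈ Set.Icc (0 : ℝ) 1,
      lam * ∑ j, (Real.sqrt (∑ l, ((t • βhat + (1 - t) • β0) j l) ^ 2)
          - Real.sqrt (∑ l, (β0 j l) ^ 2))
        ≤ ℓ (t • βhat + (1 - t) • β0) - ℓ β0 := by
  intro β0 t ht
  obtain ⟨h0, h1⟩ := ht
  have h1' : 0 ≤ 1 - t := by linarith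
  have hc := hconc.2 (Set.mem_univ βhat) (Set.mem_univ β0) h0 h1' (by ring)
  simp only [smul_eq_mul] at hc
  have hm := mul_le_mul_of_nonneg_left (hmax β0) h0
  have hN : ∑ j, Real.sqrt (∑ l, ((t • βhat + (1 - t) • β0) j l) ^ 2)
      ≤ t * ∑ j, Real.sqrt (∑ l, (βhat j l) ^ 2)
        + (1 - t) * ∑ j, Real.sqrt (∑ l, (β0 j l) ^ 2) := by
    rw [Finset.mul_sum, Finset.mul_sum, ← Finset.sum_add_distrib]
    apply Finset.sum_le_sum
    intro j _
    have key := norm_add_le (t • (WithLp.toLp 2 (βhat j) : EuclideanSpace ℝ (Fin m)))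
      ((1 - t) • (WithLp.toLp 2 (β0 j) : EuclideanSpace ℝ (Fin m)))
    rw [norm_smul, norm_smul, Real.norm_of_nonneg h0, Real.norm_of_nonneg h1'] at key
    simpa [EuclideanSpace.norm_eq] using key
  have hl := mul_le_mul_of_nonneg_left hN hlam
  rw [Finset.sum_sub_distrib]
  linarith
end

section
/- Let y ∈ ℝⁿ, let Φ be an n×(pm) real matrix with rows Φ_i ∈ ℝ^{pm} and column-blocks Φ_{(j)} (the n×m submatrix of the columns of block j), let b : ℝ → ℝ be convex and differentiable with derivative b', and let λ > 0. Define L(β) = −(1/n)·Σ_{i=1}^n [ y_i·(Φ_iᵀβ) − b(Φ_iᵀβ) ] + λ·Σ_{j=1}^p ‖β_j‖₂. Then β̂ ∈ ℝ^{pm} is a global minimizer of L if and only if for every block j: (a) if β̂_j ≠ 0 then (1/n)·Φ_{(j)}ᵀ( y − b'(Φβ̂) ) = λ·β̂_j/‖β̂_j‖₂, and (b) if β̂_j = 0 then ‖(1/n)·Φ_{(j)}ᵀ( y − b'(Φβ̂) )‖₂ ≤ λ, where b'(Φβ̂) ∈ ℝⁿ is the vector with entries b'(Φ_iᵀβ̂).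 -/
/-- The group-lasso objective for a GLM with cumulant function `b`:
`L(β) = −(1/n) Σ_i [y_i Φ_iᵀβ − b(Φ_iᵀβ)] + λ Σ_j ‖β_j‖₂`, where `β` is
partitioned into `p` blocks of length `m`. -/
noncomputable def groupLassoObj (n p m : ℕ) (y : Fin n → ℝ)
    (Φ : Matrix (Fin n) (Fin p × Fin m) ℝ) (b : ℝ → ℝ) (lam : ℝ)
    (β : Fin p → Fin m → ℝ) : ℝ :=
  -(1 / (n : ℝ)) * ∑ i, (y i * (∑ s : Fin p × Fin m, Φ i s * β s.1 s.2)
      - b (∑ s : Fin p × Fin m, Φ i s * β s.1 s.2))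
    + lam * ∑ j, Real.sqrt (∑ l, (β j l) ^ 2)

section helpers

theorem gl_block {E : Type*} [NormedAddCommGroup E] [InnerProductSpace ℝ E] (g v : E) (lam : ℝ)
    (hlam : 0 < lam) :
    (∀ u : E, inner ℝ g (u - v) ≤ lam * (‖u‖ - ‖v‖)) ↔
      (v ≠ 0 → g = (lam / ‖v‖) • v) ∧ (v = 0 → ‖g‖ ≤ lam) := by
  constructor
  · intro h
    have hg : ‖g‖ ≤ lam := by
      have h1 := h (v + g)
      rw [add_sub_cancel_left, real_inner_self_eq_norm_sq] at h1
      have h2 : ‖v + g‖ - ‖v‖ ≤ ‖g‖ := by linarith [norm_add_le v g]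
      have h3 : ‖g‖ ^ 2 ≤ lam * ‖g‖ := h1.trans (mul_le_mul_of_nonneg_left h2 hlam.le)
      by_contra! hc
      nlinarith
    refine ⟨fun hv => ?_, fun _ => hg⟩
    have hv' : 0 < ‖v‖ := norm_pos_iff.mpr hv
    have h1 := h 0
    rw [zero_sub, inner_neg_right, norm_zero] at h1
    have key : ‖g - (lam / ‖v‖) • v‖ ^ 2 ≤ 0 := by
      rw [norm_sub_sq_real, inner_smul_right, norm_smul, Real.norm_of_nonneg (by positivity),
        div_mul_cancel₀ _ hv'.ne']
      have h2 : lam * ‖v‖ ≤ inner ℝ g v := by linarith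
      have h3 : lam / ‖v‖ * (lam * ‖v‖) ≤ lam / ‖v‖ * inner ℝ g v :=
        mul_le_mul_of_nonneg_left h2 (by positivity)
      have h4 : lam / ‖v‖ * (lam * ‖v‖) = lam ^ 2 := by field_simp
      have h5 : ‖g‖ ^ 2 ≤ lam ^ 2 := pow_le_pow_left₀ (norm_nonneg _) hg 2
      linarith
    have h6 : ‖g - (lam / ‖v‖) • v‖ = 0 := by
      have := sq_nonneg ‖g - (lam / ‖v‖) • v‖
      exact pow_eq_zero_iff (two_ne_zero) |>.mp (le_antisymm key this)
    exact sub_eq_zero.mp (norm_eq_zero.mp h6)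
  · rintro ⟨ha, hb⟩ u
    by_cases hv : v = 0
    · have := hb hv
      subst hv
      rw [sub_zero, norm_zero, sub_zero]
      exact (real_inner_le_norm g u).trans (mul_le_mul_of_nonneg_right this (norm_nonneg _))
    · have hv' : 0 < ‖v‖ := norm_pos_iff.mpr hv
      rw [ha hv, inner_smul_left, inner_sub_right, real_inner_self_eq_norm_sq]
      have h1 : inner ℝ v u - ‖v‖ ^ 2 ≤ ‖v‖ * (‖u‖ - ‖v‖) := by
        nlinarith [real_inner_le_norm v u]
      have h2 := mul_le_mul_of_nonneg_left h1 (show 0 ≤ lam / ‖v‖ by positivity)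
      have h4 : lam / ‖v‖ * (‖v‖ * (‖u‖ - ‖v‖)) = lam * (‖u‖ - ‖v‖) := by field_simp
      simpa [h4] using h2

theorem gl_norm {m : ℕ} (v : Fin m → ℝ) :
    ‖WithLp.toLp 2 v‖ = Real.sqrt (∑ l, (v l) ^ 2) := by
  simp [EuclideanSpace.norm_eq]

theorem gl_block' {m : ℕ} (g v : Fin m → ℝ) (lam : ℝ) (hlam : 0 < lam) :
    (∀ u : Fin m → ℝ, ∑ l, g l * (u l - v l) ≤
        lam * (Real.sqrt (∑ l, (u l) ^ 2) - Real.sqrt (∑ l, (v l) ^ 2))) ↔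
      (v ≠ 0 → ∀ l, g l = lam * v l / Real.sqrt (∑ l', (v l') ^ 2)) ∧
      (v = 0 → Real.sqrt (∑ l, (g l) ^ 2) ≤ lam) := by
  have h := gl_block (WithLp.toLp 2 g) (WithLp.toLp 2 v) lam hlam
  have e1 : (∀ u : EuclideanSpace ℝ (Fin m), inner ℝ (WithLp.toLp 2 g) (u - WithLp.toLp 2 v)
      ≤ lam * (‖u‖ - ‖WithLp.toLp 2 v‖)) ↔
      (∀ u : Fin m → ℝ, ∑ l, g l * (u l - v l) ≤
        lam * (Real.sqrt (∑ l, (u l) ^ 2) - Real.sqrt (∑ l, (v l) ^ 2))) := by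
    constructor
    · intro H u
      have := H (WithLp.toLp 2 u)
      simp only [gl_norm, PiLp.inner_apply] at this
      simpa [mul_comm] using this
    · intro H u
      have := H (WithLp.ofLp u)
      rw [← gl_norm, ← gl_norm] at this
      simp only [PiLp.inner_apply]
      simpa [mul_comm] using this
  rw [← e1, h, gl_norm, gl_norm]
  have e2 : WithLp.toLp 2 v = 0 ↔ v = 0 := by simp
  rw [Ne, e2]
  refine and_congr (imp_congr Iff.rfl ?_) Iff.rfl
  rw [PiLp.ext_iff]
  refine forall_congr' fun l => ?_
  simp [div_mul_eq_mul_div]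

theorem gl_tangent (b b' : ℝ → ℝ) (hconv : ConvexOn ℝ Set.univ b)
    (hderiv : ∀ x, HasDerivAt b (b' x) x) (x z : ℝ) : b x + b' x * (z - x) ≤ b z := by
  rcases lt_trichotomy x z with h | h | h
  · have := hconv.le_slope_of_hasDerivAt (Set.mem_univ x) (Set.mem_univ z) h (hderiv x)
    rw [slope_def_field, le_div_iff₀ (by linarith)] at this
    linarith
  · subst h; simp
  · have := hconv.slope_le_of_hasDerivAt (Set.mem_univ z) (Set.mem_univ x) h (hderiv x)
    rw [slope_def_field, div_le_iff₀ (by linarith)] at this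
    linarith

theorem gl_deriv_nonneg (h : ℝ → ℝ) (D : ℝ) (hd : HasDerivAt h D 0)
    (hm : ∀ t, 0 < t → t < 1 → h 0 ≤ h t) : 0 ≤ D := by
  have ht := hd.tendsto_slope_zero_right
  refine ge_of_tendsto ht ?_
  filter_upwards [Ioo_mem_nhdsGT (show (0:ℝ) < 1 by norm_num)] with t ht
  have := hm t ht.1 ht.2
  have h0 : 0 ≤ t⁻¹ := inv_nonneg.mpr ht.1.le
  simp only [zero_add, smul_eq_mul]
  exact mul_nonneg h0 (by linarith)

theorem gl_swap (n p m : ℕ) (Φ : Matrix (Fin n) (Fin p × Fin m) ℝ) (c : ℝ) (r : Fin n → ℝ)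
    (d : Fin p → Fin m → ℝ) :
    ∑ j, ∑ l, (c * ∑ i, Φ i (j, l) * r i) * d j l
      = c * ∑ i, r i * ∑ s : Fin p × Fin m, Φ i s * d s.1 s.2 := by
  rw [← Fintype.sum_prod_type' (f := fun j l => (c * ∑ i, Φ i (j, l) * r i) * d j l)]
  simp only [Finset.mul_sum, Finset.sum_mul]
  rw [Finset.sum_comm]
  refine Finset.sum_congr rfl fun i _ => Finset.sum_congr rfl fun s _ => ?_
  ring

theorem gl_main (n p m : ℕ) (y : Fin n → ℝ)
    (Φ : Matrix (Fin n) (Fin p × Fin m) ℝ)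
    (b b' : ℝ → ℝ) (hconv : ConvexOn ℝ Set.univ b)
    (hderiv : ∀ x, HasDerivAt b (b' x) x)
    (lam : ℝ) (hlam : 0 < lam) (βhat : Fin p → Fin m → ℝ) :
    (∀ β : Fin p → Fin m → ℝ,
        groupLassoObj n p m y Φ b lam βhat ≤ groupLassoObj n p m y Φ b lam β)
      ↔ ∀ β : Fin p → Fin m → ℝ, ∑ j, ∑ l, ((1 / (n : ℝ)) * ∑ i, Φ i (j, l)
              * (y i - b' (∑ s : Fin p × Fin m, Φ i s * βhat s.1 s.2))) * (β j l - βhat j l)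
          ≤ lam * ∑ j, (Real.sqrt (∑ l, (β j l) ^ 2) - Real.sqrt (∑ l, (βhat j l) ^ 2)) := by
  have hT : ∀ (β : Fin p → Fin m → ℝ) (i : Fin n),
      ∑ s : Fin p × Fin m, Φ i s * (β s.1 s.2 - βhat s.1 s.2)
        = ∑ s : Fin p × Fin m, Φ i s * β s.1 s.2 - ∑ s : Fin p × Fin m, Φ i s * βhat s.1 s.2 := by
    intro β i
    simp only [mul_sub, Finset.sum_sub_distrib]
  have hn : (0 : ℝ) ≤ 1 / (n : ℝ) := by positivity
  constructor
  · intro hmin β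
    rw [gl_swap n p m Φ _ _ (fun j l => β j l - βhat j l)]
    set T : Fin n → ℝ := fun i => ∑ s : Fin p × Fin m, Φ i s * βhat s.1 s.2 with hTdef
    set d : Fin n → ℝ := fun i => ∑ s : Fin p × Fin m, Φ i s * (β s.1 s.2 - βhat s.1 s.2) with hd
    set P : ℝ := ∑ j, (Real.sqrt (∑ l, (β j l) ^ 2) - Real.sqrt (∑ l, (βhat j l) ^ 2)) with hP
    have hder : HasDerivAt (fun t : ℝ => -(1 / (n : ℝ)) * ∑ i, (y i * (T i + t * d i)
        - b (T i + t * d i)) + lam * (t * P))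
        (-(1 / (n : ℝ)) * ∑ i, (y i * d i - b' (T i) * d i) + lam * P) 0 := by
      have hlin : ∀ i, HasDerivAt (fun t : ℝ => T i + t * d i) (d i) 0 := by
        intro i
        simpa using ((hasDerivAt_id (0 : ℝ)).mul_const (d i)).const_add (T i)
      have hP' : HasDerivAt (fun t : ℝ => lam * (t * P)) (lam * P) 0 := by
        simpa using ((hasDerivAt_id (0 : ℝ)).mul_const P).const_mul lam
      refine HasDerivAt.add (HasDerivAt.const_mul _ (HasDerivAt.fun_sum fun i _ => ?_)) hP'
      refine HasDerivAt.sub ((hlin i).const_mul _) ?_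
      have hb : HasDerivAt b (b' (T i)) (T i + 0 * d i) := by simpa using hderiv (T i)
      exact hb.comp (0 : ℝ) (hlin i)
    have hD := gl_deriv_nonneg _ _ hder (by
      intro t ht0 ht1
      have h1 := hmin (fun j l => βhat j l + t * (β j l - βhat j l))
      unfold groupLassoObj at h1
      have hlin : ∀ i, ∑ s : Fin p × Fin m, Φ i s * (βhat s.1 s.2 + t * (β s.1 s.2 - βhat s.1 s.2))
          = T i + t * d i := by
        intro i
        simp only [hTdef, hd, Finset.mul_sum, ← Finset.sum_add_distrib]
        exact Finset.sum_congr rfl fun s _ => by ring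
      simp only [hlin] at h1
      have hpen : ∑ j, Real.sqrt (∑ l, (βhat j l + t * (β j l - βhat j l)) ^ 2)
          ≤ ∑ j, Real.sqrt (∑ l, (βhat j l) ^ 2) + t * P := by
        rw [hP, Finset.mul_sum, ← Finset.sum_add_distrib]
        refine Finset.sum_le_sum fun j _ => ?_
        have e : WithLp.toLp 2 (fun l => βhat j l + t * (β j l - βhat j l))
            = (1 - t) • WithLp.toLp 2 (βhat j) + t • WithLp.toLp 2 (β j) := by
          ext l; simp; ring
        have h2 := norm_add_le ((1 - t) • WithLp.toLp 2 (βhat j)) (t • WithLp.toLp 2 (β j))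
        rw [← e, norm_smul, norm_smul, gl_norm, gl_norm, gl_norm,
          Real.norm_of_nonneg ht0.le, Real.norm_of_nonneg (by linarith)] at h2
        linarith
      have h3 := mul_le_mul_of_nonneg_left hpen hlam.le
      simp only [zero_mul, add_zero, mul_zero]
      change -(1 / (n : ℝ)) * ∑ i, (y i * T i - b (T i)) + _ ≤ _ at h1
      linarith)
    have e : ∑ i, (y i * d i - b' (T i) * d i) = ∑ i, (y i - b' (T i)) * d i :=
      Finset.sum_congr rfl fun i _ => by ring
    rw [e] at hD
    linarith
  · intro h β
    have h1 := h β
    rw [gl_swap n p m Φ _ _ (fun j l => β j l - βhat j l)] at h1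
    simp only [hT] at h1
    unfold groupLassoObj
    rw [Finset.sum_sub_distrib] at h1
    have h2 : ∑ i, (y i * (∑ s : Fin p × Fin m, Φ i s * β s.1 s.2)
          - b (∑ s : Fin p × Fin m, Φ i s * β s.1 s.2))
        ≤ ∑ i, (y i * (∑ s : Fin p × Fin m, Φ i s * βhat s.1 s.2)
          - b (∑ s : Fin p × Fin m, Φ i s * βhat s.1 s.2))
        + ∑ i, (y i - b' (∑ s : Fin p × Fin m, Φ i s * βhat s.1 s.2))
          * (∑ s : Fin p × Fin m, Φ i s * β s.1 s.2
            - ∑ s : Fin p × Fin m, Φ i s * βhat s.1 s.2) := by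
      rw [← Finset.sum_add_distrib]
      refine Finset.sum_le_sum fun i _ => ?_
      have := gl_tangent b b' hconv hderiv (∑ s : Fin p × Fin m, Φ i s * βhat s.1 s.2)
        (∑ s : Fin p × Fin m, Φ i s * β s.1 s.2)
      linarith
    have h3 := mul_le_mul_of_nonneg_left h2 hn
    linarith

end helpers

/-- KKT characterization of global minimizers of the group lasso objective for a
convex, differentiable cumulant function `b`. -/
theorem stmt8
    (n p m : ℕ) (y : Fin n → ℝ)
    (Φ : Matrix (Fin n) (Fin p × Fin m) ℝ)
    (b b' : ℝ → ℝ) (hconv : ConvexOn ℝ Set.univ b)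
    (hderiv : ∀ x, HasDerivAt b (b' x) x)
    (lam : ℝ) (hlam : 0 < lam) (βhat : Fin p → Fin m → ℝ) :
    (∀ β : Fin p → Fin m → ℝ,
        groupLassoObj n p m y Φ b lam βhat ≤ groupLassoObj n p m y Φ b lam β)
      ↔ ∀ j : Fin p,
        (βhat j ≠ 0 → ∀ l : Fin m,
          (1 / (n : ℝ)) * ∑ i, Φ i (j, l)
              * (y i - b' (∑ s : Fin p × Fin m, Φ i s * βhat s.1 s.2))
            = lam * βhat j l / Real.sqrt (∑ l', (βhat j l') ^ 2)) ∧
        (βhat j = 0 →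
          Real.sqrt (∑ l, ((1 / (n : ℝ)) * ∑ i, Φ i (j, l)
              * (y i - b' (∑ s : Fin p × Fin m, Φ i s * βhat s.1 s.2))) ^ 2)
            ≤ lam) := by
  rw [gl_main n p m y Φ b b' hconv hderiv lam hlam βhat]
  refine Iff.trans ?_ (forall_congr' fun j => gl_block' (fun l => (1 / (n : ℝ)) * ∑ i, Φ i (j, l)
              * (y i - b' (∑ s : Fin p × Fin m, Φ i s * βhat s.1 s.2))) (βhat j) lam hlam)
  constructor
  · intro h j u
    have := h (Function.update βhat j u)
    rw [Finset.sum_eq_single j, Finset.sum_eq_single j] at this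
    · simpa using this
    · intro k _ hk; simp [Function.update_of_ne hk]
    · simp
    · intro k _ hk; simp [Function.update_of_ne hk]
    · simp
  · intro h β
    rw [Finset.mul_sum]
    exact Finset.sum_le_sum fun j _ => h j (β j)
end

section
/- Let y ∈ ℝⁿ, let Φ be an n×(pm) real matrix with rows Φ_i, let b : ℝ → ℝ be convex and twice differentiable, and let λ ≥ 0. Suppose β̂ is a global minimizer of L(β) = −(1/n)·Σ_{i=1}^n [ y_i·(Φ_iᵀβ) − b(Φ_iᵀβ) ] + λ·Σ_{j=1}^p ‖β_j‖₂. Then for every β⁰ ∈ ℝ^{pm} and every t ∈ [0,1], setting β* = t β̂ + (1−t) β⁰, there exists t* ∈ [0,1] such that with β** = β⁰ + t*(β*−β⁰) and Δ = β*−β⁰: (1/(2n))·Σ_{i=1}^n b''(Φ_iᵀβ**)·(Φ_iᵀΔ)² ≤ (1/n)·Σ_{i=1}^n ( y_i − b'(Φ_iᵀβ⁰) )·(Φ_iᵀΔ) + λ·Σ_{j=1}^p ( ‖β⁰_j‖₂ − ‖β*_j‖₂ ). -/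
theorem taylor_aux {n : ℕ} (b b' b'' : ℝ → ℝ)
    (hb' : ∀ x, HasDerivAt b (b' x) x)
    (hb'' : ∀ x, HasDerivAt b' (b'' x) x) (x d : Fin n → ℝ) :
    ∃ c ∈ Set.Icc (0 : ℝ) 1, ∑ i, b'' (x i + c * d i) * d i ^ 2
      = 2 * (∑ i, b (x i + d i) - ∑ i, b (x i) - ∑ i, b' (x i) * d i) := by
  set K := ∑ i, b (x i + d i) - ∑ i, b (x i) - ∑ i, b' (x i) * d i with hK
  have hlin : ∀ (i : Fin n) (s : ℝ), HasDerivAt (fun s : ℝ => x i + s * d i) (d i) s := by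
    intro i s
    simpa using ((hasDerivAt_id s).mul_const (d i)).const_add (x i)
  have h1 : ∀ s : ℝ, HasDerivAt (fun s : ℝ => ∑ i, b (x i + s * d i))
      (∑ i, b' (x i + s * d i) * d i) s := fun s =>
    HasDerivAt.fun_sum fun i _ => (hb' (x i + s * d i)).comp s (hlin i s)
  have h2 : ∀ s : ℝ, HasDerivAt (fun s : ℝ => ∑ i, b' (x i + s * d i) * d i)
      (∑ i, b'' (x i + s * d i) * d i * d i) s := fun s =>
    HasDerivAt.fun_sum fun i _ => ((hb'' (x i + s * d i)).comp s (hlin i s)).mul_const (d i)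
  have h3 : ∀ s : ℝ, HasDerivAt (fun s : ℝ => 1 - s) (-1) s := fun s => by
    simpa using (hasDerivAt_id s).const_sub 1
  have hG := fun s : ℝ => ((h1 s).fun_add ((h3 s).fun_mul (h2 s))).fun_add
    (((h3 s).fun_mul (h3 s)).const_mul K)
  obtain ⟨c, hc, hc0⟩ := exists_hasDerivAt_eq_zero (zero_lt_one (α := ℝ))
    (fun s _ => (hG s).continuousAt.continuousWithinAt) (by simp [hK]) (fun s _ => hG s)
  refine ⟨c, Set.Ioo_subset_Icc_self hc, ?_⟩
  have hne : (1 - c) ≠ 0 := by have := hc.2; intro h; linarith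
  have e : ∑ i, b'' (x i + c * d i) * d i ^ 2 = ∑ i, b'' (x i + c * d i) * d i * d i :=
    Finset.sum_congr rfl fun i _ => by ring
  rw [e]
  apply mul_left_cancel₀ hne
  linarith

theorem norm_aux {m : ℕ} (u v : Fin m → ℝ) (t : ℝ) (h0 : 0 ≤ t) (h1 : 0 ≤ 1 - t) :
    Real.sqrt (∑ l, (t * u l + (1 - t) * v l) ^ 2)
      ≤ t * Real.sqrt (∑ l, (u l) ^ 2) + (1 - t) * Real.sqrt (∑ l, (v l) ^ 2) := by
  have h := norm_add_le (t • WithLp.toLp 2 u : EuclideanSpace ℝ (Fin m))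
    ((1 - t) • WithLp.toLp 2 v)
  rw [norm_smul, norm_smul, Real.norm_of_nonneg h0, Real.norm_of_nonneg h1] at h
  simpa [EuclideanSpace.norm_eq] using h

/-- The basic inequality for the group lasso GLM estimator: combining the
minimizing property with a Lagrange-form Taylor expansion of the log-likelihood. -/
theorem stmt11
    (n p m : ℕ) (y : Fin n → ℝ)
    (Φ : Matrix (Fin n) (Fin p × Fin m) ℝ)
    (b b' b'' : ℝ → ℝ) (hconv : ConvexOn ℝ Set.univ b)
    (hb' : ∀ x, HasDerivAt b (b' x) x)
    (hb'' : ∀ x, HasDerivAt b' (b'' x) x)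
    (lam : ℝ) (hlam : 0 ≤ lam) (βhat : Fin p → Fin m → ℝ)
    (hmin : ∀ β : Fin p → Fin m → ℝ,
      -(1 / (n : ℝ)) * ∑ i, (y i * (∑ s : Fin p × Fin m, Φ i s * βhat s.1 s.2)
            - b (∑ s : Fin p × Fin m, Φ i s * βhat s.1 s.2))
          + lam * ∑ j, Real.sqrt (∑ l, (βhat j l) ^ 2)
        ≤ -(1 / (n : ℝ)) * ∑ i, (y i * (∑ s : Fin p × Fin m, Φ i s * β s.1 s.2)
            - b (∑ s : Fin p × Fin m, Φ i s * β s.1 s.2))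
          + lam * ∑ j, Real.sqrt (∑ l, (β j l) ^ 2)) :
    ∀ β0 : Fin p → Fin m → ℝ, ∀ t ∈ Set.Icc (0 : ℝ) 1,
      ∃ tstar ∈ Set.Icc (0 : ℝ) 1,
        (1 / (2 * (n : ℝ))) * ∑ i,
            b'' (∑ s : Fin p × Fin m, Φ i s
                * (β0 s.1 s.2 + tstar * ((t • βhat + (1 - t) • β0) s.1 s.2 - β0 s.1 s.2)))
              * (∑ s : Fin p × Fin m, Φ i s
                  * ((t • βhat + (1 - t) • β0) s.1 s.2 - β0 s.1 s.2)) ^ 2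
          ≤ (1 / (n : ℝ)) * ∑ i,
              (y i - b' (∑ s : Fin p × Fin m, Φ i s * β0 s.1 s.2))
                * (∑ s : Fin p × Fin m, Φ i s
                    * ((t • βhat + (1 - t) • β0) s.1 s.2 - β0 s.1 s.2))
            + lam * ∑ j, (Real.sqrt (∑ l, (β0 j l) ^ 2)
                - Real.sqrt (∑ l, ((t • βhat + (1 - t) • β0) j l) ^ 2)) := by
  intro β0 t ht
  have ht0 := ht.1
  have ht1 : 0 ≤ 1 - t := by linarith [ht.2]
  set βs : Fin p → Fin m → ℝ := t • βhat + (1 - t) • β0 with hβs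
  have hv : ∀ j l, βs j l = t * βhat j l + (1 - t) * β0 j l := fun j l => by simp [hβs]
  clear_value βs
  set uh : Fin n → ℝ := fun i => ∑ s : Fin p × Fin m, Φ i s * βhat s.1 s.2 with huh
  set u0 : Fin n → ℝ := fun i => ∑ s : Fin p × Fin m, Φ i s * β0 s.1 s.2 with hu0
  set d : Fin n → ℝ := fun i => ∑ s : Fin p × Fin m, Φ i s * (βs s.1 s.2 - β0 s.1 s.2) with hd
  have hdu : ∀ i, u0 i + d i = t * uh i + (1 - t) * u0 i := by
    intro i
    simp only [hd, hu0, huh, hv, Finset.mul_sum, ← Finset.sum_add_distrib]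
    exact Finset.sum_congr rfl fun s _ => by ring
  obtain ⟨c, hc, hT⟩ := taylor_aux b b' b'' hb' hb'' u0 d
  refine ⟨c, hc, ?_⟩
  have hc' : ∀ i, ∑ s : Fin p × Fin m, Φ i s * (β0 s.1 s.2 + c * (βs s.1 s.2 - β0 s.1 s.2))
      = u0 i + c * d i := by
    intro i
    simp only [hd, hu0, Finset.mul_sum, ← Finset.sum_add_distrib]
    exact Finset.sum_congr rfl fun s _ => by ring
  have hm := hmin β0
  change -(1 / (n : ℝ)) * ∑ i, (y i * uh i - b (uh i)) + lam * ∑ j, Real.sqrt (∑ l, (βhat j l) ^ 2)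
    ≤ -(1 / (n : ℝ)) * ∑ i, (y i * u0 i - b (u0 i)) + lam * ∑ j, Real.sqrt (∑ l, (β0 j l) ^ 2) at hm
  simp only [hc']
  change 1 / (2 * (n : ℝ)) * ∑ i, b'' (u0 i + c * d i) * d i ^ 2
    ≤ 1 / (n : ℝ) * ∑ i, (y i - b' (u0 i)) * d i + _
  rw [hT, Finset.sum_sub_distrib]
  have hN : ∑ j, Real.sqrt (∑ l, (βs j l) ^ 2) ≤ t * ∑ j, Real.sqrt (∑ l, (βhat j l) ^ 2)
      + (1 - t) * ∑ j, Real.sqrt (∑ l, (β0 j l) ^ 2) := by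
    simp only [hv, Finset.mul_sum, ← Finset.sum_add_distrib]
    exact Finset.sum_le_sum fun j _ => norm_aux (βhat j) (β0 j) t ht0 ht1
  have hA : ∑ i, b (u0 i + d i) ≤ t * ∑ i, b (uh i) + (1 - t) * ∑ i, b (u0 i) := by
    simp only [Finset.mul_sum, ← Finset.sum_add_distrib]
    refine Finset.sum_le_sum fun i _ => ?_
    rw [hdu]
    simpa using hconv.2 (Set.mem_univ (uh i)) (Set.mem_univ (u0 i)) ht0 ht1 (by ring)
  have hY : ∑ i, y i * d i = t * ∑ i, y i * uh i - t * ∑ i, y i * u0 i := by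
    simp only [Finset.mul_sum, ← Finset.sum_sub_distrib]
    refine Finset.sum_congr rfl fun i _ => ?_
    have : d i = t * uh i - t * u0 i := by linarith [hdu i]
    rw [this]; ring
  simp only [sub_mul, Finset.sum_sub_distrib] at hm ⊢
  have hn : 0 ≤ 1 / (n : ℝ) := by positivity
  have e2 : 1 / (2 * (n : ℝ)) = 1 / (n : ℝ) / 2 := by rw [div_div, mul_comm]
  rw [e2, hY]
  have k1 := mul_le_mul_of_nonneg_left hN hlam
  have k2 := mul_le_mul_of_nonneg_left hA hn
  have k3 := mul_le_mul_of_nonneg_left hm ht0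
  linarith
end
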